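/- Let 0 < β < α, κ > 0 and A ≥ 0, and set γ := (2κΓ(1 − β/α))^{α/(α−β)}. Suppose f : [0,∞) → [0,∞) is measurable, sup_{t≥0} e^{−γt} f(t) < ∞, and f(t) ≤ A + κ ∫_0^t (t − s)^{−β/α} f(s) ds for every t ≥ 0. Then f(t) ≤ 2A e^{γt} for every t ≥ 0. -/

import Mathlib

open MeasureTheory

/-- The convolution of the kernel `u ^ (-p)` with a function dominated by `C e^{γ s}` is at most
the Laplace transform of the kernel times `C e^{γ t}`. -/
theorem setIntegral_sub_rpow_mul_le {p γ C : ℝ} (hp : p < 1) (hγ : 0 < γ) {f : ℝ → ℝ}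
    (hf : ∀ s : ℝ, 0 ≤ s → 0 ≤ f s) (hfC : ∀ s : ℝ, 0 ≤ s → f s ≤ C * Real.exp (γ * s)) (t : ℝ) :
    ∫ s in Set.Ioo (0 : ℝ) t, (t - s) ^ (-p) * f s ≤
      C * Real.exp (γ * t) * (γ ^ (p - 1) * Real.Gamma (1 - p)) := by
  have hC : 0 ≤ C := by simpa using (hf 0 le_rfl).trans (hfC 0 le_rfl)
  set K : ℝ → ℝ := (Set.Ioi 0).indicator fun u => u ^ (-p) * Real.exp (-(γ * u)) with hK
  have hK_nonneg : ∀ u, 0 ≤ K u := fun u =>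
    Set.indicator_nonneg (fun u hu => mul_nonneg (Real.rpow_nonneg (le_of_lt hu) _)
      (Real.exp_pos _).le) u
  have hK_integral : ∫ u, K u = γ ^ (p - 1) * Real.Gamma (1 - p) := by
    have h := Real.integral_rpow_mul_exp_neg_mul_Ioi (sub_pos.2 hp) hγ
    rw [hK, integral_indicator measurableSet_Ioi]
    rw [show 1 - p - 1 = -p by ring] at h
    rw [h, one_div, Real.inv_rpow hγ.le, ← Real.rpow_neg hγ.le, neg_sub]
  have hK_integrable : Integrable K := by
    refine Integrable.of_integral_ne_zero ?_
    rw [hK_integral]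
    exact (mul_pos (Real.rpow_pos_of_pos hγ _) (Real.Gamma_pos_of_pos (sub_pos.2 hp))).ne'
  have hKt : Integrable fun s => K (t - s) := hK_integrable.comp_sub_left t
  calc ∫ s in Set.Ioo (0 : ℝ) t, (t - s) ^ (-p) * f s
      ≤ ∫ s in Set.Ioo (0 : ℝ) t, C * Real.exp (γ * t) * K (t - s) := by
        refine integral_mono_of_nonneg ?_ (hKt.const_mul _).integrableOn ?_
        · filter_upwards [ae_restrict_mem measurableSet_Ioo] with s hs
          exact mul_nonneg (Real.rpow_nonneg (sub_nonneg.2 hs.2.le) _) (hf s hs.1.le)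
        · filter_upwards [ae_restrict_mem measurableSet_Ioo] with s hs
          have hts : t - s ∈ Set.Ioi (0 : ℝ) := sub_pos.2 hs.2
          calc (t - s) ^ (-p) * f s ≤ (t - s) ^ (-p) * (C * Real.exp (γ * s)) :=
                mul_le_mul_of_nonneg_left (hfC s hs.1.le)
                  (Real.rpow_nonneg (sub_nonneg.2 hs.2.le) _)
            _ = C * Real.exp (γ * t) * K (t - s) := by
                rw [hK, Set.indicator_of_mem hts,
                  show γ * s = γ * t + -(γ * (t - s)) by ring, Real.exp_add]
                ring
    _ = C * Real.exp (γ * t) * ∫ s in Set.Ioo (0 : ℝ) t, K (t - s) := integral_const_mul _ _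
    _ ≤ C * Real.exp (γ * t) * ∫ s, K (t - s) :=
        mul_le_mul_of_nonneg_left
          (setIntegral_le_integral hKt (Filter.Eventually.of_forall fun s => hK_nonneg _))
          (mul_nonneg hC (Real.exp_pos _).le)
    _ = C * Real.exp (γ * t) * (γ ^ (p - 1) * Real.Gamma (1 - p)) := by
        rw [integral_sub_left_eq_self K volume t, hK_integral]

/-- a fractional Gronwall-type lemma: if
`f(t) ≤ A + κ ∫_0^t (t-s)^{-β/α} f(s) ds` and `e^{-γt} f(t)` is bounded, where
`γ = (2κΓ(1-β/α))^{α/(α-β)}`, then `f(t) ≤ 2A e^{γt}`. -/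
theorem fractional_gronwall (α β κ A : ℝ) (hβ : 0 < β) (hβα : β < α)
    (hκ : 0 < κ) (hA : 0 ≤ A)
    (γ : ℝ) (hγ : γ = (2 * κ * Real.Gamma (1 - β / α)) ^ (α / (α - β)))
    (f : ℝ → ℝ) (hfmeas : Measurable f) (hfnonneg : ∀ t : ℝ, 0 ≤ t → 0 ≤ f t)
    (hfbdd : ∃ M : ℝ, ∀ t : ℝ, 0 ≤ t → Real.exp (-γ * t) * f t ≤ M)
    (hineq : ∀ t : ℝ, 0 ≤ t →
      f t ≤ A + κ * ∫ s in Set.Ioo (0 : ℝ) t, (t - s) ^ (-(β / α)) * f s) :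
    ∀ t : ℝ, 0 ≤ t → f t ≤ 2 * A * Real.exp (γ * t) := by
  have hα : 0 < α := hβ.trans hβα
  have hp : β / α < 1 := (div_lt_one hα).2 hβα
  have hΓ : 0 < Real.Gamma (1 - β / α) := Real.Gamma_pos_of_pos (sub_pos.2 hp)
  have hb : 0 < 2 * κ * Real.Gamma (1 - β / α) := by positivity
  have hγ_pos : 0 < γ := hγ ▸ Real.rpow_pos_of_pos hb _
  have hγ_rpow : γ ^ (β / α - 1) = (2 * κ * Real.Gamma (1 - β / α))⁻¹ := by
    have hαβ : α - β ≠ 0 := (sub_pos.2 hβα).ne'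
    rw [hγ, ← Real.rpow_mul hb.le, ← Real.rpow_neg_one]
    congr 1
    field_simp
    ring
  have hhalf : κ * (γ ^ (β / α - 1) * Real.Gamma (1 - β / α)) = 1 / 2 := by
    rw [hγ_rpow]
    generalize Real.Gamma (1 - β / α) = G at hΓ
    field_simp
  let g : Set.Ici (0 : ℝ) → ℝ := fun t => Real.exp (-γ * t) * f t
  have hg : BddAbove (Set.range g) := by
    obtain ⟨M, hM⟩ := hfbdd
    exact ⟨M, by rintro _ ⟨t, rfl⟩; exact hM t t.2⟩
  have hexp : ∀ t : ℝ, Real.exp (-γ * t) * Real.exp (γ * t) = 1 := fun t => by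
    rw [← Real.exp_add]
    simp
  have hf_le : ∀ t : ℝ, 0 ≤ t → f t ≤ (⨆ s, g s) * Real.exp (γ * t) := fun t ht => by
    calc f t = Real.exp (-γ * t) * f t * Real.exp (γ * t) := by linear_combination -f t * hexp t
      _ ≤ (⨆ s, g s) * Real.exp (γ * t) :=
        mul_le_mul_of_nonneg_right (le_ciSup hg ⟨t, ht⟩) (Real.exp_pos _).le
  have hsup : (⨆ s, g s) ≤ A + (⨆ s, g s) / 2 := by
    have : Nonempty (Set.Ici (0 : ℝ)) := ⟨⟨0, Set.self_mem_Ici⟩⟩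
    refine ciSup_le fun ⟨t, ht⟩ => ?_
    have hint := mul_le_mul_of_nonneg_left
      (setIntegral_sub_rpow_mul_le hp hγ_pos hfnonneg hf_le t) hκ.le
    have hft : f t ≤ A + (⨆ s, g s) / 2 * Real.exp (γ * t) := by
      linear_combination hineq t ht + hint + (⨆ s, g s) * Real.exp (γ * t) * hhalf
    have hexp_le : Real.exp (-γ * t) ≤ 1 :=
      Real.exp_le_one_iff.2 (mul_nonpos_of_nonpos_of_nonneg (neg_nonpos.2 hγ_pos.le) ht)
    calc Real.exp (-γ * t) * f t
        ≤ Real.exp (-γ * t) * (A + (⨆ s, g s) / 2 * Real.exp (γ * t)) :=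
          mul_le_mul_of_nonneg_left hft (Real.exp_pos _).le
      _ = Real.exp (-γ * t) * A + (⨆ s, g s) / 2 := by
          linear_combination (⨆ s, g s) / 2 * hexp t
      _ ≤ A + (⨆ s, g s) / 2 := by
          gcongr
          exact mul_le_of_le_one_left hA hexp_le
  intro t ht
  exact (hf_le t ht).trans (mul_le_mul_of_nonneg_right (by linarith) (Real.exp_pos _).le)
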